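/- Let m, n ≥ 2 and let W be a normalized m×n entanglement witness whose smallest eigenvalue equals −1/2. Then W is decomposable, i.e., there exist positive semidefinite matrices P and Q with W = P + Q^Γ. (In other words, the infimum −1/2 of the smallest eigenvalue is never attained by a nondecomposable entanglement witness.) -/

import Mathlib

open Matrix ComplexOrder

noncomputable section

/-- The product vector `a ⊗ b`. -/
def prodVec {m n : ℕ} (a : Fin m → ℂ) (b : Fin n → ℂ) : Fin m × Fin n → ℂ :=
  fun p => a p.1 * b p.2

/-- `W` is block-positive: Hermitian, and the quadratic form on every product
vector is real and nonnegative. -/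
def BlockPositive {m n : ℕ} (W : Matrix (Fin m × Fin n) (Fin m × Fin n) ℂ) : Prop :=
  W.IsHermitian ∧ ∀ (a : Fin m → ℂ) (b : Fin n → ℂ),
    0 ≤ (star (prodVec a b) ⬝ᵥ W.mulVec (prodVec a b)).re ∧
    (star (prodVec a b) ⬝ᵥ W.mulVec (prodVec a b)).im = 0

/-- Partial transpose: `M^Γ ((i,k),(j,l)) = M ((j,k),(i,l))`. -/
def ptrans {m n : ℕ} (M : Matrix (Fin m × Fin n) (Fin m × Fin n) ℂ) :
    Matrix (Fin m × Fin n) (Fin m × Fin n) ℂ :=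
  fun p q => M (q.1, p.2) (p.1, q.2)

/-- `W` is decomposable: `W = P + Q^Γ` with `P, Q` positive semidefinite. -/
def Decomposable {m n : ℕ} (W : Matrix (Fin m × Fin n) (Fin m × Fin n) ℂ) : Prop :=
  ∃ P Q : Matrix (Fin m × Fin n) (Fin m × Fin n) ℂ,
    P.PosSemidef ∧ Q.PosSemidef ∧ W = P + ptrans Q

/-- Negativity: absolute value of the sum of the negative eigenvalues. -/
noncomputable def negativity {N : Type*} [Fintype N] [DecidableEq N]
    {W : Matrix N N ℂ} (hW : W.IsHermitian) : ℝ :=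
  ∑ i, max (-(hW.eigenvalues i)) 0

/-- The eigenvalues of a Hermitian matrix, listed in non-increasing order with
multiplicity. -/
noncomputable def sortedEigs {N : Type*} [Fintype N] [DecidableEq N]
    {W : Matrix N N ℂ} (hW : W.IsHermitian) : List ℝ :=
  (Finset.univ.val.map hW.eigenvalues).sort (· ≥ ·)


lemma svd_frame {m n : ℕ} (V : Matrix (Fin m) (Fin n) ℂ) :
    ∃ (U : Matrix (Fin m) (Fin m ⊕ Fin n) ℂ) (F : Matrix (Fin n) (Fin m ⊕ Fin n) ℂ)
      (s : Fin m ⊕ Fin n → ℝ), U * Uᴴ = 1 ∧ F * Fᴴ = 1 ∧ (∀ k, 0 ≤ s k) ∧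
      ((∑ k, s k ^ 2 : ℝ) : ℂ) = (V * Vᴴ).trace ∧
      V = U * Matrix.diagonal (fun k => (s k : ℂ)) * Fᵀ := by
  have hps : (V * Vᴴ).PosSemidef := Matrix.posSemidef_self_mul_conjTranspose V
  have hH := hps.1
  set U0 : Matrix (Fin m) (Fin m) ℂ := (hH.eigenvectorUnitary : Matrix (Fin m) (Fin m) ℂ) with hU0
  have hUU : U0 * U0ᴴ = 1 := by
    have := (Matrix.mem_unitaryGroup_iff).1 hH.eigenvectorUnitary.2
    simpa [star_eq_conjTranspose] using this
  have hUU' : U0ᴴ * U0 = 1 := by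
    have := (Matrix.mem_unitaryGroup_iff').1 hH.eigenvectorUnitary.2
    simpa [star_eq_conjTranspose] using this
  set d := hH.eigenvalues with hd
  have hd0 : ∀ i, 0 ≤ d i := fun i => hps.eigenvalues_nonneg i
  have hspec : V * Vᴴ = U0 * diagonal (fun i => (d i : ℂ)) * U0ᴴ := by
    have := hH.spectral_theorem
    simpa [Unitary.conjStarAlgAut_apply, star_eq_conjTranspose, Function.comp_def] using this
  set N := U0ᴴ * V with hN
  have hNN : N * Nᴴ = diagonal (fun i => (d i : ℂ)) := by
    calc N * Nᴴ = U0ᴴ * (V * Vᴴ) * U0 := by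
          simp [hN, Matrix.conjTranspose_mul, Matrix.mul_assoc]
      _ = (U0ᴴ * U0) * diagonal (fun i => (d i : ℂ)) * (U0ᴴ * U0) := by
          rw [hspec]; simp [Matrix.mul_assoc]
      _ = _ := by simp [hUU']
  set t : Fin m → ℝ := fun i => Real.sqrt (d i) with ht
  have htt : ∀ i, t i * t i = d i := fun i => Real.mul_self_sqrt (hd0 i)
  have hN0 : ∀ i, t i = 0 → ∀ j, N i j = 0 := by
    intro i hi j
    have h1 : (N * Nᴴ) i i = 0 := by
      rw [hNN]; simp [← htt i, hi]
    have h2 : star (N i) ⬝ᵥ N i = 0 := by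
      simpa [Matrix.mul_apply, dotProduct, mul_comm] using h1
    have := dotProduct_star_self_eq_zero.1 h2
    exact congrFun this j
  set G : Matrix (Fin m) (Fin n) ℂ := fun i j => (t i : ℂ)⁻¹ * N i j with hG
  have hGN : diagonal (fun i => (t i : ℂ)) * G = N := by
    ext i j
    rw [Matrix.diagonal_mul]
    by_cases h : t i = 0
    · simp [h, hN0 i h j]
    · have : (t i : ℂ) ≠ 0 := by exact_mod_cast h
      simp [hG, this]
  have hGG : G * Gᴴ = diagonal (fun i => if t i = 0 then (0:ℂ) else 1) := by
    ext i j
    have h1 : (G * Gᴴ) i j = (t i : ℂ)⁻¹ * (t j : ℂ)⁻¹ * (N * Nᴴ) i j := by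
      rw [Matrix.mul_apply, Matrix.mul_apply, Finset.mul_sum]
      refine Finset.sum_congr rfl fun x _ => ?_
      rw [Matrix.conjTranspose_apply, Matrix.conjTranspose_apply]
      simp [hG]
      ring
    rw [h1, hNN]
    by_cases hij : i = j
    · subst hij
      by_cases h : t i = 0
      · simp [h]
      · have h' : (t i : ℂ) ≠ 0 := by exact_mod_cast h
        simp only [diagonal_apply_eq, h, if_false, ← htt i]
        push_cast
        field_simp
    · simp [hij]
  have hEG : (G * Gᴴ) * G = G := by
    rw [hGG]
    ext i j
    rw [Matrix.diagonal_mul]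
    by_cases h : t i = 0
    · simp [h, hG]
    · simp [h]
  set C : Matrix (Fin n) (Fin n) ℂ := Gᵀ * Gᵀᴴ with hC
  have hCH : Cᴴ = C := by simp [hC]
  have hCC : C * C = C := by
    have : C = (Gᴴ * G)ᵀ := by
      rw [hC, Matrix.transpose_mul]; rfl
    rw [this, ← Matrix.transpose_mul]
    congr 1
    calc Gᴴ * G * (Gᴴ * G) = Gᴴ * ((G * Gᴴ) * G) := by simp [Matrix.mul_assoc]
      _ = _ := by rw [hEG]
  refine ⟨Matrix.fromCols U0 0, Matrix.fromCols Gᵀ (1 - C), Sum.elim t 0, ?_, ?_, ?_, ?_, ?_⟩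
  · rw [Matrix.conjTranspose_fromCols_eq_fromRows_conjTranspose, Matrix.fromCols_mul_fromRows]
    simp [hUU]
  · rw [Matrix.conjTranspose_fromCols_eq_fromRows_conjTranspose, Matrix.fromCols_mul_fromRows, ← hC]
    simp [hCH, Matrix.mul_sub, Matrix.sub_mul, hCC]
  · rintro (k | k) <;> simp [ht]
  · rw [hspec, Matrix.trace_mul_comm, ← Matrix.mul_assoc, hUU', Matrix.one_mul, Matrix.trace_diagonal]
    simp [Fintype.sum_sum_type, pow_two, ← htt]
  · have : (diagonal fun k => ((Sum.elim t 0 k : ℝ) : ℂ)) =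
        Matrix.fromBlocks (diagonal (fun i => (t i : ℂ))) 0 0 (0 : Matrix (Fin n) (Fin n) ℂ) := by
      rw [← Matrix.diagonal_zero, Matrix.fromBlocks_diagonal]
      congr 1
      ext k
      cases k <;> simp
    rw [this, Matrix.fromCols_mul_fromBlocks, Matrix.transpose_fromCols, Matrix.fromCols_mul_fromRows]
    simp [Matrix.mul_assoc, hGN]
    rw [hN, ← Matrix.mul_assoc, hUU, Matrix.one_mul]

def qf {K : Type*} [Fintype K] (W : Matrix (K × K) (K × K) ℂ) (a b : K → ℂ) : ℂ :=
  ∑ i, ∑ j, ∑ k, ∑ l, star (a i * b j) * W (i, j) (k, l) * (a k * b l)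

def ph (x : Fin 4) : ℂ := Complex.I ^ x.val

lemma ph_succ (x : Fin 4) : ph (x + 1) = Complex.I * ph x := by
  fin_cases x <;> simp [ph, pow_succ]

lemma ph_star_mul (x : Fin 4) : star (ph x) * ph x = 1 := by
  fin_cases x <;> simp [ph, pow_succ]

section core
variable {K : Type*} [Fintype K] [DecidableEq K]

lemma ph_shift (e : K → Fin 4) (r i : K) :
    ph ((e + Pi.single r (1 : Fin 4) : K → Fin 4) i) = (if i = r then Complex.I else 1) * ph (e i) := by
  by_cases h : i = r
  · subst h; simp [ph_succ]
  · simp [h]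

def chS (i j k l : K) : ℂ :=
  ∑ e : K → Fin 4, star (ph (e i)) * ph (e j) * ph (e k) * star (ph (e l))

lemma zero_of_shift (f : (K → Fin 4) → ℂ) (r : K) (c : ℂ) (hc : c ≠ 1)
    (h : ∀ e, f (e + Pi.single r (1 : Fin 4) : K → Fin 4) = c * f e) : ∑ e, f e = 0 := by
  have h1 : ∑ e : K → Fin 4, f (e + Pi.single r (1 : Fin 4) : K → Fin 4) = ∑ e, f e :=
    Equiv.sum_comp (Equiv.addRight (Pi.single r (1 : Fin 4) : K → Fin 4)) f
  simp only [h, ← Finset.mul_sum] at h1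
  have : (c - 1) * ∑ e, f e = 0 := by rw [sub_mul, h1]; ring
  exact (mul_eq_zero.1 this).resolve_left (sub_ne_zero.2 hc)

lemma chS_two (i j : K) (h : i ≠ j) :
    ∑ e : K → Fin 4, ph (e i) * star (ph (e j)) = 0 := by
  apply zero_of_shift _ i Complex.I
  · intro h; simpa using congrArg Complex.re h
  · intro e
    rw [ph_shift, ph_shift]
    simp [h.symm, mul_assoc]

lemma chS_eq (i j k l : K) : chS i j k l = (Fintype.card (K → Fin 4) : ℂ) *
    ((if i = j ∧ k = l then 1 else 0) + (if i = k ∧ j = l then 1 else 0)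
      - (if i = j ∧ i = k ∧ i = l then 1 else 0)) := by
  unfold chS
  by_cases h1 : i = j
  · subst h1
    simp only [ph_star_mul, one_mul]
    by_cases h2 : k = l
    · subst h2
      have : ∀ x, ph x * star (ph x) = 1 := fun x => by rw [mul_comm]; exact ph_star_mul x
      simp only [this]
      by_cases h3 : i = k <;> simp [h3]
    · rw [chS_two _ _ h2]
      by_cases h3 : i = k
      · subst h3; simp [h2]
      · simp [h2, h3]
  · by_cases h2 : i = k
    · subst h2
      have : ∀ e : K → Fin 4, star (ph (e i)) * ph (e j) * ph (e i) * star (ph (e l))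
          = ph (e j) * star (ph (e l)) := by
        intro e
        calc _ = (star (ph (e i)) * ph (e i)) * (ph (e j) * star (ph (e l))) := by ring
          _ = _ := by rw [ph_star_mul, one_mul]
      simp only [this]
      by_cases h3 : j = l
      · subst h3
        have : ∀ x, ph x * star (ph x) = 1 := fun x => by rw [mul_comm]; exact ph_star_mul x
        simp only [this]
        simp [h1]
      · rw [chS_two _ _ h3]; simp [h1, h3]
    · simp only [h1, h2, false_and, if_false]
      rw [zero_of_shift _ i (-Complex.I * (if l = i then -Complex.I else 1))]
      · simp
      · intro h
        by_cases hl : l = i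
        · simp [hl] at h; norm_num [Complex.ext_iff] at h
        · simp [hl] at h; norm_num [Complex.ext_iff] at h
      · intro e
        simp only [ph_shift, Ne.symm (Ne.intro h1 : i ≠ j), Ne.symm (Ne.intro h2 : i ≠ k), if_true, if_false]
        by_cases hl : l = i
        · simp [hl]; ring_nf; simp
        · simp [hl]; ring

lemma avg_ineq (W : Matrix (K × K) (K × K) ℂ) (hW : ∀ a b, 0 ≤ (qf W a b).re)
    (s : K → ℝ) (hs : ∀ k, 0 ≤ s k) :
    0 ≤ (∑ i, ∑ k, s i * s k * (W (i, i) (k, k)).re)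
      + (∑ i, ∑ j, s i * s j * (W (i, j) (i, j)).re) - ∑ i, s i * s i * (W (i, i) (i, i)).re := by
  set r : K → ℝ := fun i => Real.sqrt (s i) with hr
  have hrr : ∀ i, r i * r i = s i := fun i => Real.mul_self_sqrt (hs i)
  have key : ∑ e : K → Fin 4, qf W (fun i => r i * ph (e i)) (fun i => r i * star (ph (e i)))
      = (Fintype.card (K → Fin 4) : ℂ) * 
        ((∑ i, ∑ k, (s i * s k : ℂ) * (W (i, i) (k, k)))
      + (∑ i, ∑ j, (s i * s j : ℂ) * (W (i, j) (i, j))) - ∑ i, (s i * s i : ℂ) * (W (i, i) (i, i))) := by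
    have h1 : ∑ e : K → Fin 4, qf W (fun i => r i * ph (e i)) (fun i => r i * star (ph (e i)))
        = ∑ i, ∑ j, ∑ k, ∑ l, (r i * r j * r k * r l : ℂ) * W (i, j) (k, l) * chS i j k l := by
      unfold qf chS
      simp only [Finset.mul_sum]
      rw [Finset.sum_comm]; refine Finset.sum_congr rfl fun i _ => ?_
      rw [Finset.sum_comm]; refine Finset.sum_congr rfl fun j _ => ?_
      rw [Finset.sum_comm]; refine Finset.sum_congr rfl fun k _ => ?_
      rw [Finset.sum_comm]; refine Finset.sum_congr rfl fun l _ => ?_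
      refine Finset.sum_congr rfl fun e _ => ?_
      simp
      ring
    rw [h1]
    have hs' : ∀ i, (s i : ℂ) = r i * r i := fun i => by rw [← hrr i]; push_cast; ring
    simp only [chS_eq, mul_sub, mul_add, Finset.sum_add_distrib, Finset.sum_sub_distrib, Finset.mul_sum, ite_and]
    simp only [mul_ite, mul_one, mul_zero, Finset.sum_ite_eq, Finset.mem_univ, if_true, Finset.sum_ite_irrel, Finset.sum_const_zero]
    simp only [hs']
    congr 1
    · congr 1
      · refine Finset.sum_congr rfl fun i _ => Finset.sum_congr rfl fun j _ => ?_
        ring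
      · refine Finset.sum_congr rfl fun i _ => Finset.sum_congr rfl fun j _ => ?_
        ring
    · refine Finset.sum_congr rfl fun i _ => ?_
      ring
  have h0 : 0 ≤ (∑ e : K → Fin 4, qf W (fun i => r i * ph (e i)) (fun i => r i * star (ph (e i)))).re := by
    rw [Complex.re_sum]; exact Finset.sum_nonneg fun e _ => hW _ _
  rw [key] at h0
  have hpos : (0:ℝ) < (Fintype.card (K → Fin 4) : ℝ) := by exact_mod_cast Fintype.card_pos
  rw [← Complex.ofReal_natCast, Complex.re_ofReal_mul] at h0
  have h2 := nonneg_of_mul_nonneg_right h0 hpos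
  simp only [Complex.sub_re, Complex.add_re, Complex.re_sum, ← Complex.ofReal_mul, Complex.re_ofReal_mul] at h2
  exact h2

/-- 2x2 restriction. -/
lemma four_term (W : Matrix (K × K) (K × K) ℂ) (hW : ∀ a b, 0 ≤ (qf W a b).re)
    (i k j l : K) (x y z w : ℂ) :
    0 ≤ (star (x*z) * (x*z) * W (i,j) (i,j) + star (x*z) * (x*w) * W (i,j) (i,l)
      + star (x*z) * (y*z) * W (i,j) (k,j) + star (x*z) * (y*w) * W (i,j) (k,l)
      + star (x*w) * (x*z) * W (i,l) (i,j) + star (x*w) * (x*w) * W (i,l) (i,l)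
      + star (x*w) * (y*z) * W (i,l) (k,j) + star (x*w) * (y*w) * W (i,l) (k,l)
      + star (y*z) * (x*z) * W (k,j) (i,j) + star (y*z) * (x*w) * W (k,j) (i,l)
      + star (y*z) * (y*z) * W (k,j) (k,j) + star (y*z) * (y*w) * W (k,j) (k,l)
      + star (y*w) * (x*z) * W (k,l) (i,j) + star (y*w) * (x*w) * W (k,l) (i,l)
      + star (y*w) * (y*z) * W (k,l) (k,j) + star (y*w) * (y*w) * W (k,l) (k,l)).re := by
  have := hW (fun t => (if t = i then x else 0) + (if t = k then y else 0))
    (fun t => (if t = j then z else 0) + (if t = l then w else 0))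
  convert this using 2
  unfold qf
  simp only [star_mul', star_add, apply_ite star, star_zero, add_mul, mul_add, Finset.sum_add_distrib,
    ite_mul, mul_ite, zero_mul, mul_zero, Finset.sum_ite_eq', Finset.sum_ite_irrel, Finset.sum_const_zero, Finset.mem_univ, if_true]
  ring

lemma lin0 (c : ℝ) (W : ℂ) (h : ∀ x : ℂ, 0 ≤ c + 2 * (x * W).re) : W = 0 := by
  by_contra hW
  have hp : 0 < Complex.normSq W := Complex.normSq_pos.2 hW
  have h1 := h (-((((c + 1) / Complex.normSq W : ℝ)) : ℂ) * star W)
  have h2 : -((((c + 1) / Complex.normSq W : ℝ)) : ℂ) * star W * W = ((-(c + 1) : ℝ) : ℂ) := by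
    rw [mul_assoc]
    have : star W * W = (Complex.normSq W : ℂ) := by
      rw [Complex.normSq_eq_conj_mul_self]; rfl
    rw [this, neg_mul, ← Complex.ofReal_mul, div_mul_cancel₀ _ hp.ne']
    push_cast; ring
  rw [h2, Complex.ofReal_re] at h1
  have h3 := h 0
  simp at h3
  linarith

lemma nrm (x : ℂ) (r : ℂ) : (star x * x * r).re = Complex.normSq x * r.re := by
  have : star x * x = (Complex.normSq x : ℂ) := by
    rw [Complex.normSq_eq_conj_mul_self]; rfl
  rw [this, Complex.re_ofReal_mul]

lemma row0 (W : Matrix (K × K) (K × K) ℂ) (hH : ∀ p q, W q p = star (W p q))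
    (hW : ∀ a b, 0 ≤ (qf W a b).re) (i j l : K)
    (h : (W (i,j) (i,j)).re = 0) : W (i,j) (i,l) = 0 := by
  apply lin0 (W (i,l) (i,l)).re
  intro z
  have := four_term W hW i i j l 1 0 (star z) 1
  rw [hH (i,j) (i,l)] at this
  simp at this
  have e : ((starRingEnd ℂ) z * (starRingEnd ℂ) (W (i, j) (i, l))).re = (z * W (i,j) (i,l)).re := by
    simp
  have e2 := nrm (star z) (W (i,j) (i,j))
  simp [h] at *
  linarith

lemma col0 (W : Matrix (K × K) (K × K) ℂ) (hH : ∀ p q, W q p = star (W p q))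
    (hW : ∀ a b, 0 ≤ (qf W a b).re) (i k j : K)
    (h : (W (i,j) (i,j)).re = 0) : W (i,j) (k,j) = 0 := by
  apply lin0 (W (k,j) (k,j)).re
  intro z
  have := four_term W hW i k j j (star z) 1 1 0
  rw [hH (i,j) (k,j)] at this
  simp at this
  have e2 := nrm (star z) (W (i,j) (i,j))
  simp [h] at *
  linarith

lemma lemB (W : Matrix (K × K) (K × K) ℂ) (hH : ∀ p q, W q p = star (W p q))
    (hW : ∀ a b, 0 ≤ (qf W a b).re) (i k j l : K) (x y z w : ℂ) :
    0 ≤ Complex.normSq (x*z) * (W (i,j) (i,j)).re + Complex.normSq (x*w) * (W (i,l) (i,l)).re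
      + Complex.normSq (y*z) * (W (k,j) (k,j)).re + Complex.normSq (y*w) * (W (k,l) (k,l)).re
      + 2 * (star (x*z) * (y*w) * W (i,j) (k,l)).re := by
  have h1 := four_term W hW i k j l x y z w
  have h2 := four_term W hW i k j l x (Complex.I * y) z (-Complex.I * w)
  have h3 := four_term W hW i k j l x (-y) z (-w)
  have h4 := four_term W hW i k j l x (-Complex.I * y) z (Complex.I * w)
  have h := add_nonneg (add_nonneg h1 h2) (add_nonneg h3 h4)
  have e : (star (x*z) * (y*w) * W (i,j) (k,l)).re = (star (y*w) * (x*z) * W (k,l) (i,j)).re := by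
    rw [hH (i,j) (k,l), ← Complex.conj_re]
    congr 1
    simp only [map_mul, RCLike.star_def, Complex.conj_conj]
    ring
  rw [← nrm, ← nrm, ← nrm, ← nrm, two_mul]
  nth_rewrite 2 [e]
  rw [← Complex.add_re, ← Complex.add_re, ← Complex.add_re] at h
  rw [← Complex.add_re, ← Complex.add_re, ← Complex.add_re, ← Complex.add_re, ← Complex.add_re]
  have key : ∀ t : ℂ, 0 ≤ (4 * t).re → 0 ≤ t.re := by
    intro t ht; simp at ht; exact ht
  apply key
  refine h.trans_eq (congrArg Complex.re ?_)
  simp only [star_mul', star_neg]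
  have hI : star Complex.I = - Complex.I := Complex.conj_I
  have hI3 : Complex.I ^ 3 = - Complex.I := Complex.I_pow_three
  have hI4 : Complex.I ^ 4 = 1 := Complex.I_pow_four
  simp only [hI]
  ring_nf
  simp only [Complex.I_sq, hI3, hI4]
  ring

lemma van (W : Matrix (K × K) (K × K) ℂ) (hH : ∀ p q, W q p = star (W p q))
    (hW : ∀ a b, 0 ≤ (qf W a b).re) (i k j l : K)
    (h1 : (W (i,j) (i,j)).re = 0 ∨ (W (k,l) (k,l)).re = 0)
    (h2 : (W (i,l) (i,l)).re = 0 ∨ (W (k,j) (k,j)).re = 0) : W (i,j) (k,l) = 0 := by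
  have B := lemB W hH hW i k j l
  rcases h1 with h1 | h1 <;> rcases h2 with h2 | h2
  · apply lin0 ((W (k,j) (k,j)).re + (W (k,l) (k,l)).re)
    intro t
    simpa [h1, h2] using B (star t) 1 1 1
  · apply lin0 ((W (i,l) (i,l)).re + (W (k,l) (k,l)).re)
    intro t
    simpa [h1, h2] using B 1 1 (star t) 1
  · apply lin0 ((W (i,j) (i,j)).re + (W (k,j) (k,j)).re)
    intro t
    simpa [h1, h2] using B 1 1 1 t
  · apply lin0 ((W (i,j) (i,j)).re + (W (i,l) (i,l)).re)
    intro t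
    simpa [h1, h2] using B 1 t 1 1

set_option maxHeartbeats 2000000 in
lemma core (W : Matrix (K × K) (K × K) ℂ) (hH : ∀ p q, W q p = star (W p q))
    (hW : ∀ a b, 0 ≤ (qf W a b).re) (htr : ∑ i, ∑ j, (W (i,j) (i,j)).re = 1)
    (s : K → ℝ) (hs : ∀ k, 0 ≤ s k) (hs1 : ∑ k, s k ^ 2 = 1)
    (hmin : ∑ i, ∑ k, s i * s k * (W (i, i) (k, k)).re = -(1/2)) :
    ∃ i j, i ≠ j ∧ W = (1/2 : ℂ) • (Matrix.single (i,j) (i,j) 1 + Matrix.single (j,i) (j,i) 1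
      - Matrix.single (i,i) (j,j) 1 - Matrix.single (j,j) (i,i) 1) := by
  have hD : ∀ i j, 0 ≤ (W (i,j) (i,j)).re := by
    intro i j
    have := four_term W hW i i j j 1 0 1 0
    simpa using this
  have hss : ∀ i j, i ≠ j → s i ^ 2 + s j ^ 2 ≤ 1 := by
    intro i j hij
    rw [← hs1, ← Finset.sum_pair (f := fun k => s k ^ 2) hij]
    exact Finset.sum_le_sum_of_subset_of_nonneg (Finset.subset_univ _) (fun _ _ _ => sq_nonneg _)
  have hav := avg_ineq W hW s hs
  rw [hmin] at hav
  set c : K → K → ℝ := fun i j => if i = j then 0 else s i * s j with hc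
  have hc2 : ∀ i j, c i j ≤ 1/2 := by
    intro i j
    by_cases h : i = j
    · simp [hc, h]
    · simp only [hc, h, if_false]
      nlinarith [hss i j h, sq_nonneg (s i - s j)]
  have hsum : (∑ i, ∑ j, s i * s j * (W (i, j) (i, j)).re) - ∑ i, s i * s i * (W (i, i) (i, i)).re
      = ∑ i, ∑ j, c i j * (W (i,j) (i,j)).re := by
    rw [← Finset.sum_sub_distrib]
    refine Finset.sum_congr rfl fun i _ => ?_
    rw [sub_eq_iff_eq_add, ← Finset.sum_erase_add _ _ (Finset.mem_univ i), ← Finset.sum_erase_add (f := fun j => c i j * _) _ (Finset.mem_univ i)]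
    simp only [hc, if_true, zero_mul, add_zero]
    congr 1
    refine Finset.sum_congr rfl fun j hj => ?_
    rw [if_neg (Finset.ne_of_mem_erase hj).symm]
  have hz : ∑ i, ∑ j, (1/2 - c i j) * (W (i,j) (i,j)).re ≤ 0 := by
    simp only [sub_mul, Finset.sum_sub_distrib, ← Finset.mul_sum, htr]
    linarith
  have hnn : ∀ i j, 0 ≤ (1/2 - c i j) * (W (i,j) (i,j)).re := fun i j =>
    mul_nonneg (by linarith [hc2 i j]) (hD i j)
  have hall : ∀ i j, (1/2 - c i j) * (W (i,j) (i,j)).re = 0 := by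
    have h0 := le_antisymm hz (Finset.sum_nonneg fun i _ => Finset.sum_nonneg fun j _ => hnn i j)
    intro i j
    have h1 := (Finset.sum_eq_zero_iff_of_nonneg (fun i _ => Finset.sum_nonneg fun j _ => hnn i j)).1 h0 i (Finset.mem_univ i)
    exact (Finset.sum_eq_zero_iff_of_nonneg (fun j _ => hnn i j)).1 h1 j (Finset.mem_univ j)
  have hex : ∃ i j, (W (i,j) (i,j)).re ≠ 0 := by
    by_contra hcon
    push Not at hcon
    simp [hcon] at htr
  have hpair : ∀ i j, (W (i,j) (i,j)).re ≠ 0 → i ≠ j ∧ s i * s j = 1/2 := by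
    intro i j hij
    have h1 := (mul_eq_zero.1 (hall i j)).resolve_right hij
    by_cases h : i = j
    · simp [hc, h] at h1
    · simp only [hc, h, if_false] at h1
      exact ⟨h, by linarith⟩
  obtain ⟨i, j, hij0⟩ := hex
  obtain ⟨hij, hsij⟩ := hpair i j hij0
  have hsi : s i ^ 2 = 1/2 ∧ s j ^ 2 = 1/2 := by
    have h1 := hss i j hij
    have h2 : (s i - s j)^2 = 0 := le_antisymm (by nlinarith) (sq_nonneg _)
    have h3 : s i = s j := by nlinarith [pow_eq_zero_iff (two_ne_zero) |>.1 h2]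
    constructor
    · nlinarith
    · nlinarith
  have hso : ∀ k, k ≠ i → k ≠ j → s k = 0 := by
    intro k hki hkj
    have h1 : ∑ t ∈ ({i, j, k} : Finset K), s t ^ 2 ≤ 1 := by
      rw [← hs1]
      exact Finset.sum_le_sum_of_subset_of_nonneg (Finset.subset_univ _) (fun _ _ _ => sq_nonneg _)
    rw [Finset.sum_insert (by simp [hij, hki.symm]), Finset.sum_pair hkj.symm] at h1
    have : s k ^ 2 = 0 := le_antisymm (by linarith) (sq_nonneg _)
    exact pow_eq_zero_iff (two_ne_zero) |>.1 this
  have hD0 : ∀ a b, ¬ ((a = i ∧ b = j) ∨ (a = j ∧ b = i)) → (W (a,b) (a,b)).re = 0 := by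
    intro a b hab
    by_contra hne
    obtain ⟨h1, h2⟩ := hpair a b hne
    have ha : s a ≠ 0 := by rintro h; simp [h] at h2
    have hb : s b ≠ 0 := by rintro h; simp [h] at h2
    have ha' : a = i ∨ a = j := by
      by_contra h; push Not at h; exact ha (hso a h.1 h.2)
    have hb' : b = i ∨ b = j := by
      by_contra h; push Not at h; exact hb (hso b h.1 h.2)
    grind
  have him : ∀ p, (W p p).im = 0 := by
    intro p
    have := congrArg Complex.im (hH p p)
    simp at this
    linarith
  -- reduce sums to two terms
  have hsub : ∀ f : K → ℝ, (∀ k, k ≠ i → k ≠ j → f k = 0) → ∑ k, f k = f i + f j := by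
    intro f hf
    rw [← Finset.sum_pair hij]
    symm
    apply Finset.sum_subset (Finset.subset_univ _)
    intro k _ hk
    simp at hk
    exact hf k hk.1 hk.2
  have hii : (W (i,i) (i,i)).re = 0 := hD0 _ _ (by grind)
  have hjj : (W (j,j) (j,j)).re = 0 := hD0 _ _ (by grind)
  have htr2 : (W (i,j) (i,j)).re + (W (j,i) (j,i)).re = 1 := by
    rw [hsub, hsub, hsub] at htr
    · linarith
    · intro k h1 h2; exact hD0 _ _ (by grind)
    · intro k h1 h2; exact hD0 _ _ (by grind)
    · intro k h1 h2; exact Finset.sum_eq_zero fun l _ => hD0 _ _ (by grind)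
  have hre : (W (i,i) (j,j)).re = -(1/2) := by
    rw [hsub, hsub, hsub] at hmin
    · rw [hH (i,i) (j,j), hii, hjj, mul_comm (s j) (s i), hsij] at hmin
      simp at hmin
      linarith
    · intro k h1 h2; simp [hso k h1 h2]
    · intro k h1 h2; simp [hso k h1 h2]
    · intro k h1 h2; simp [hso k h1 h2]
  have hDij : (W (i,j) (i,j)).re = 1/2 := by
    have h1 := lemB W hH hW i j i j 1 (2 * (W (i,j) (i,j)).re : ℝ) 1 1
    simp only [hii, hjj, mul_one, one_mul, star_one, Complex.re_ofReal_mul, hre, map_one, Complex.normSq_ofReal] at h1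
    have hp : 0 < (W (i,j) (i,j)).re := lt_of_le_of_ne (hD i j) (Ne.symm hij0)
    have h2 : (W (j,i) (j,i)).re = 1 - (W (i,j) (i,j)).re := by linarith
    rw [h2] at h1
    set D := (W (i,j) (i,j)).re
    have h3 : 0 ≤ D * (-(2 * D - 1)^2) := by nlinarith
    have h4 := nonneg_of_mul_nonneg_right h3 hp
    have h5 : (2 * D - 1)^2 = 0 := le_antisymm (by linarith) (sq_nonneg _)
    have h6 := pow_eq_zero_iff (two_ne_zero) |>.1 h5
    linarith
  have hDji : (W (j,i) (j,i)).re = 1/2 := by linarith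
  have hW1 : W (i,i) (j,j) = -(1/2) := by
    have h1 := lemB W hH hW i j i j 1 (-2 * star (W (i,i) (j,j))) 1 1
    have h2 : star (1 * 1 : ℂ) * (-2 * star (W (i,i) (j,j)) * 1) * W (i,i) (j,j)
        = ((-2 * Complex.normSq (W (i,i) (j,j)) : ℝ) : ℂ) := by
      push_cast
      rw [Complex.normSq_eq_conj_mul_self]
      simp [mul_assoc]
    rw [h2, Complex.ofReal_re] at h1
    simp [hii, hjj, hDij, hDji] at h1
    have h3 : Complex.normSq (W (i,i) (j,j)) ≤ 1/4 := by
      norm_num at h1; linarith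
    rw [Complex.normSq_apply, hre] at h3
    have h4 : (W (i,i) (j,j)).im = 0 := by nlinarith
    apply Complex.ext
    · rw [hre]; norm_num
    · rw [h4]; norm_num
  have hW2 : W (j,j) (i,i) = -(1/2) := by rw [hH (i,i) (j,j), hW1]; simp
  have hrow := row0 W hH hW
  have hcol := col0 W hH hW
  have hrowz : ∀ a b d, b ≠ d → W (a,b) (a,d) = 0 := by
    intro a b d hbd
    by_cases h : (W (a,b) (a,b)).re = 0
    · exact hrow _ _ _ h
    · have h' : (W (a,d) (a,d)).re = 0 := by
        apply hD0
        have := mt (hD0 a b) h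
        grind
      rw [hH (a,d) (a,b), hrow _ _ _ h', star_zero]
  have hcolz : ∀ a c b, a ≠ c → W (a,b) (c,b) = 0 := by
    intro a c b hbd
    by_cases h : (W (a,b) (a,b)).re = 0
    · exact hcol _ _ _ h
    · have h' : (W (c,b) (c,b)).re = 0 := by
        apply hD0
        have := mt (hD0 a b) h
        grind
      rw [hH (c,b) (a,b), hcol _ _ _ h', star_zero]
  have hdd : ∀ p, W p p = ((W p p).re : ℂ) := by
    intro p
    apply Complex.ext <;> simp [him]
  have hW3 : W (i,j) (j,i) = 0 := by
    have F : ∀ w : ℂ, 0 ≤ (star w * star w * W (i,j) (j,i)).re := by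
      intro w
      have h1 := four_term W hW i j i j 1 (star w) 1 w
      rw [hH (i,j) (j,i), hW1, hW2, hdd (i,i), hdd (j,j), hdd (i,j), hdd (j,i), hii, hjj, hDij, hDji,
        hrowz i i j hij, hrowz i j i hij.symm, hrowz j i j hij, hrowz j j i hij.symm,
        hcolz i j i hij, hcolz i j j hij, hcolz j i i hij.symm, hcolz j i j hij.symm] at h1
      simp at h1 ⊢
      ring_nf at h1 ⊢
      linarith
    have f1 := F 1
    have f2 := F Complex.I
    have f3 := F (1 + Complex.I)
    have f4 := F (1 - Complex.I)
    simp at f1 f2 f3 f4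
    apply Complex.ext <;> simp <;> linarith
  have hW4 : W (j,i) (i,j) = 0 := by rw [hH (i,j) (j,i), hW3]; simp
  refine ⟨i, j, hij, ?_⟩
  ext ⟨a, b⟩ ⟨c', d⟩
  simp only [Matrix.smul_apply, Matrix.sub_apply, Matrix.add_apply, Matrix.single_apply, Prod.mk.injEq, smul_eq_mul]
  by_cases hac : a = c'
  · subst hac
    by_cases hbd : b = d
    · subst hbd
      rw [hdd]
      by_cases g1 : a = i ∧ b = j
      · obtain ⟨rfl, rfl⟩ := g1
        rw [hDij]; simp [hij, hij.symm]
      · by_cases g2 : a = j ∧ b = i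
        · obtain ⟨rfl, rfl⟩ := g2
          rw [hDji]; simp [hij, hij.symm]
        · rw [hD0 a b (by tauto)]
          have : ¬ (i = a ∧ j = b) := by grind
          have : ¬ (j = a ∧ i = b) := by grind
          grind
    · rw [hrowz a b d hbd]
      grind
  · by_cases hbd : b = d
    · subst hbd
      rw [hcolz a c' b hac]
      grind
    · by_cases g1 : (a = i ∧ c' = j) ∧ b = i ∧ d = j
      · obtain ⟨⟨rfl, rfl⟩, rfl, rfl⟩ := g1
        rw [hW1]; simp [hij, hij.symm]
      by_cases g2 : (a = j ∧ c' = i) ∧ b = j ∧ d = i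
      · obtain ⟨⟨rfl, rfl⟩, rfl, rfl⟩ := g2
        rw [hW2]; simp [hij, hij.symm]
      by_cases g3 : (a = i ∧ c' = j) ∧ b = j ∧ d = i
      · obtain ⟨⟨rfl, rfl⟩, rfl, rfl⟩ := g3
        rw [hW3]; simp [hij, hij.symm]
      by_cases g4 : (a = j ∧ c' = i) ∧ b = i ∧ d = j
      · obtain ⟨⟨rfl, rfl⟩, rfl, rfl⟩ := g4
        rw [hW4]; simp [hij, hij.symm]
      rw [van W hH hW a c' b d]
      · grind
      · by_cases h : (a = i ∧ b = j) ∨ (a = j ∧ b = i)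
        · right; apply hD0; grind
        · left; exact hD0 _ _ h
      · by_cases h : (a = i ∧ d = j) ∨ (a = j ∧ d = i)
        · right; apply hD0; grind
        · left; exact hD0 _ _ h

end core

/-- A normalized `m × n` entanglement witness whose smallest eigenvalue equals
`-1/2` is decomposable. -/
theorem stmt_16 {m n : ℕ} (hm : 2 ≤ m) (hn : 2 ≤ n)
    (W : Matrix (Fin m × Fin n) (Fin m × Fin n) ℂ)
    (hBP : BlockPositive W) (hNP : ¬ W.PosSemidef) (htr : W.trace = 1)
    (hmin : (⨅ i, hBP.1.eigenvalues i) = -(1 / 2)) :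
    Decomposable W := by
  classical
  obtain ⟨hH, hpos⟩ := hBP
  have hne : Nonempty (Fin m × Fin n) := ⟨(⟨0, by omega⟩, ⟨0, by omega⟩)⟩
  obtain ⟨i0, hi0⟩ := exists_eq_ciInf_of_finite (f := hH.eigenvalues)
  rw [hmin] at hi0
  set v : Fin m × Fin n → ℂ := ⇑(hH.eigenvectorBasis i0) with hv
  have hWv : W *ᵥ v = ((-(1/2) : ℝ) : ℂ) • v := by
    have := hH.mulVec_eigenvectorBasis i0
    rw [hi0] at this
    exact this
  have hvv : star v ⬝ᵥ v = 1 := by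
    have h1 := hH.eigenvectorBasis.orthonormal.1 i0
    have h2 : inner ℂ (hH.eigenvectorBasis i0) (hH.eigenvectorBasis i0) = (1 : ℂ) := by
      rw [inner_self_eq_norm_sq_to_K, h1]; simp
    rw [EuclideanSpace.inner_eq_star_dotProduct, dotProduct_comm] at h2
    exact h2
  obtain ⟨U, F, s, hU, hF, hs, hs2, hV⟩ := svd_frame (Matrix.of fun i j => v (i, j))
  set T : Matrix (Fin m × Fin n) ((Fin m ⊕ Fin n) × (Fin m ⊕ Fin n)) ℂ :=
    Matrix.kroneckerMap (· * ·) U F with hT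
  have hTT : T * Tᴴ = 1 := by
    rw [hT, Matrix.conjTranspose_kronecker, ← Matrix.mul_kronecker_mul, hU, hF, Matrix.one_kronecker_one]
  set W' := Tᴴ * W * T with hW'
  have hWW : W = T * W' * Tᴴ := by
    calc W = (T * Tᴴ) * W * (T * Tᴴ) := by simp [hTT]
      _ = _ := by simp [hW', Matrix.mul_assoc]
  have hH' : W'.IsHermitian := by
    rw [hW']; exact Matrix.isHermitian_conjTranspose_mul_mul T hH
  have hqf : ∀ a b, qf W' a b = star (prodVec (U *ᵥ a) (F *ᵥ b)) ⬝ᵥ W *ᵥ (prodVec (U *ᵥ a) (F *ᵥ b)) := by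
    intro a b
    set d : (Fin m ⊕ Fin n) × (Fin m ⊕ Fin n) → ℂ := fun p => a p.1 * b p.2 with hd
    have h1 : prodVec (U *ᵥ a) (F *ᵥ b) = T *ᵥ d := by
      ext p
      simp only [prodVec, mulVec, dotProduct, hT, kroneckerMap_apply, hd, Fintype.sum_prod_type,
        Finset.sum_mul_sum]
      refine Finset.sum_congr rfl fun x _ => Finset.sum_congr rfl fun y _ => ?_
      ring
    have h2 : star (T *ᵥ d) ⬝ᵥ W *ᵥ (T *ᵥ d) = star d ⬝ᵥ W' *ᵥ d := by
      rw [Matrix.star_mulVec, hW', ← Matrix.dotProduct_mulVec, Matrix.mulVec_mulVec, Matrix.mulVec_mulVec, Matrix.mul_assoc]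
    rw [h1, h2]
    simp only [qf, dotProduct, mulVec, Fintype.sum_prod_type, hd, Finset.mul_sum, Pi.star_apply]
    refine Finset.sum_congr rfl fun x _ => Finset.sum_congr rfl fun y _ => 
      Finset.sum_congr rfl fun z _ => Finset.sum_congr rfl fun w _ => ?_
    ring
  have htr' : W'.trace = 1 := by
    rw [hW', Matrix.trace_mul_comm, ← Matrix.mul_assoc, hTT, Matrix.one_mul, htr]
  have hvT : v = T *ᵥ (fun p => if p.1 = p.2 then (s p.1 : ℂ) else 0) := by
    ext ⟨x, y⟩
    have h1 := congrFun (congrFun hV x) y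
    rw [Matrix.of_apply] at h1
    rw [h1]
    have h3 : ∀ z, (U * diagonal fun k => (s k : ℂ)) x z = U x z * s z := fun z => by
      rw [Matrix.mul_diagonal]
    rw [Matrix.mul_apply]
    simp only [h3, mulVec, dotProduct, hT, kroneckerMap_apply, Fintype.sum_prod_type,
      Matrix.transpose_apply, mul_ite, mul_zero, Finset.sum_ite_eq, Finset.mem_univ, if_true]
    refine Finset.sum_congr rfl fun z _ => ?_
    ring
  have hcond : ∑ i, ∑ k, s i * s k * (W' (i, i) (k, k)).re = -(1/2) := by
    have h1 : star v ⬝ᵥ W *ᵥ v = ((-(1/2) : ℝ) : ℂ) := by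
      rw [hWv, dotProduct_smul, hvv]; simp
    have h2 : ∀ d, star (T *ᵥ d) ⬝ᵥ W *ᵥ (T *ᵥ d) = star d ⬝ᵥ W' *ᵥ d := by
      intro d
      rw [Matrix.star_mulVec, hW', ← Matrix.dotProduct_mulVec, Matrix.mulVec_mulVec, Matrix.mulVec_mulVec, Matrix.mul_assoc]
    rw [hvT, h2] at h1
    have h3 := congrArg Complex.re h1
    rw [Complex.ofReal_re] at h3
    rw [← h3]
    simp only [dotProduct, mulVec, Fintype.sum_prod_type, Pi.star_apply, apply_ite star, star_zero,
      mul_ite, mul_zero, ite_mul, zero_mul, Finset.sum_ite_eq, Finset.mem_univ, if_true]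
    simp only [Finset.mul_sum, Complex.re_sum]
    refine Finset.sum_congr rfl fun x _ => Finset.sum_congr rfl fun y _ => ?_
    simp
    ring
  have hs1 : ∑ k, s k ^ 2 = 1 := by
    have h1 : ((Matrix.of fun i j => v (i, j)) * (Matrix.of fun i j => v (i, j))ᴴ).trace = star v ⬝ᵥ v := by
      simp only [Matrix.trace, Matrix.diag, Matrix.mul_apply, dotProduct, Fintype.sum_prod_type,
        Matrix.conjTranspose_apply, Matrix.of_apply, Pi.star_apply]
      refine Finset.sum_congr rfl fun x _ => Finset.sum_congr rfl fun y _ => ?_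
      ring
    rw [h1, hvv] at hs2
    exact_mod_cast hs2
  obtain ⟨i, j, hij, hfin⟩ := core W' (fun p q => (hH'.apply q p).symm)
    (fun a b => by rw [hqf]; exact (hpos _ _).1)
    (by
      have := congrArg Complex.re htr'
      simpa [Matrix.trace, Fintype.sum_prod_type] using this) s hs hs1 hcond
  have hent : ∀ p q, W p q = (1/2 : ℂ) * (T p (i,j) * star (T q (i,j)) + T p (j,i) * star (T q (j,i))
      - T p (i,i) * star (T q (j,j)) - T p (j,j) * star (T q (i,i))) := by
    intro p q
    have key : ∀ a b, (T * Matrix.single a b (1:ℂ) * Tᴴ) p q = T p a * star (T q b) := by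
      intro a b
      rw [Matrix.mul_apply, Finset.sum_eq_single b]
      · simp
      · intro c _ hc
        rw [Matrix.mul_single_apply_of_ne (hbj := hc)]; simp
      · simp
    rw [hWW, hfin]
    simp only [Matrix.mul_smul, Matrix.smul_mul, Matrix.mul_add, Matrix.mul_sub, Matrix.add_mul, Matrix.sub_mul,
      Matrix.smul_apply, Matrix.add_apply, Matrix.sub_apply, key, smul_eq_mul]
  set φ : Fin m × Fin n → ℂ := fun p => star (U p.1 i) * F p.2 j - star (U p.1 j) * F p.2 i with hφ
  refine ⟨0, (1/2 : ℝ) • Matrix.vecMulVec φ (star φ), Matrix.PosSemidef.zero,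
    (Matrix.posSemidef_vecMulVec_self_star φ).smul (by norm_num), ?_⟩
  ext p q
  rw [hent]
  simp only [zero_add, ptrans, Matrix.smul_apply, Matrix.vecMulVec_apply, hφ, hT, kroneckerMap_apply, Pi.star_apply,
    star_sub, star_mul', star_star, Complex.real_smul]
  push_cast
  ring

end
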